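/- Let v and w be adjacent, unlooped, unmarked vertices of the marked graph G, and suppose no neighbor of v is marked. Then [G] = A²·[G^{vw} − v − w] + AB·[(G^{vw})^v − v − w] + B·[G^v − v]. -/

import Mathlib

open MvPolynomial

/-- A marked graph: a finite vertex set, an adjacency matrix over GF(2)
(the diagonal entry at `v` is 1 iff `v` carries a loop; for `v ≠ w` the `(v,w)` entry
is 1 iff `v` and `w` are adjacent), a designated set of marked vertices, and a number
of free loops. -/
structure MarkedGraph (V : Type) [Fintype V] [DecidableEq V] where
  adj : Matrix V V (ZMod 2)
  marked : V → Bool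
  freeLoops : ℕ

namespace MarkedGraph

variable {V : Type} [Fintype V] [DecidableEq V]

/-- GF(2)-nullity of a square matrix: the dimension of its kernel. -/
noncomputable def nullity {ι : Type*} [Fintype ι] (M : Matrix ι ι (ZMod 2)) : ℕ :=
  Module.finrank (ZMod 2) (LinearMap.ker M.mulVecLin)

/-- The diagonal matrix `Δ_T` over GF(2) whose diagonal entry at `v` is 1 iff `v ∈ T`. -/
def delta (T : Finset V) : Matrix V V (ZMod 2) :=
  Matrix.diagonal fun v => if v ∈ T then 1 else 0

/-- The vertices kept in the submatrix `𝒜(G)_T`: delete each marked vertex whose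
diagonal entry in `𝒜(G) + Δ_T` is 0. -/
def keep (G : MarkedGraph V) (T : Finset V) : Finset V :=
  Finset.univ.filter fun v => ¬ (G.marked v = true ∧ (G.adj + delta T) v v = 0)

/-- The submatrix `𝒜(G)_T` of `𝒜(G) + Δ_T`. -/
def subMat (G : MarkedGraph V) (T : Finset V) :
    Matrix (G.keep T) (G.keep T) (ZMod 2) :=
  fun i j => (G.adj + delta T) i.1 j.1

/-- The marked-graph bracket polynomial `[G] ∈ ℤ[A,B,d]`, where `A = X 0`, `B = X 1`,
`d = X 2`:  `[G] = d^φ ⬝ Σ_{T ⊆ V(G)} A^(n-|T|) B^(|T|) d^(ν(𝒜(G)_T))`. -/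
noncomputable def bracket (G : MarkedGraph V) : MvPolynomial (Fin 3) ℤ :=
  X 2 ^ G.freeLoops *
    ∑ T : Finset V,
      X 0 ^ (Fintype.card V - T.card) * X 1 ^ T.card * X 2 ^ nullity (G.subMat T)

/-- `x` is a neighbor of `v` (no vertex is a neighbor of itself). -/
def nbr (G : MarkedGraph V) (v x : V) : Prop := x ≠ v ∧ G.adj v x = 1

instance (G : MarkedGraph V) (v x : V) : Decidable (G.nbr v x) :=
  inferInstanceAs (Decidable (x ≠ v ∧ G.adj v x = 1))

/-- Delete the vertices in `s`, together with all incident edges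
(marks and free loops unchanged). -/
def delete (G : MarkedGraph V) (s : Finset V) : MarkedGraph {v : V // v ∉ s} where
  adj := fun i j => G.adj i.1 j.1
  marked := fun i => G.marked i.1
  freeLoops := G.freeLoops

/-- The local complement `G^v`: toggle every entry of the adjacency matrix (diagonal
entries included) whose row and column indices are both neighbors of `v`. -/
def localComp (G : MarkedGraph V) (v : V) : MarkedGraph V :=
  { G with adj := fun x y => if G.nbr v x ∧ G.nbr v y then G.adj x y + 1 else G.adj x y }

/-- `G - {v,v}`: remove the loop at `v` (set the diagonal entry at `v` to 0). -/
def removeLoop (G : MarkedGraph V) (v : V) : MarkedGraph V :=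
  { G with adj := fun x y => if x = v ∧ y = v then 0 else G.adj x y }

/-- `G + I`: toggle all loops. -/
def addI (G : MarkedGraph V) : MarkedGraph V :=
  { G with adj := G.adj + 1 }

/-- `G⁺`: adjoin one free loop. -/
def addFreeLoop (G : MarkedGraph V) : MarkedGraph V :=
  { G with freeLoops := G.freeLoops + 1 }

/-- The condition under which the pivot `G^{vw}` toggles the adjacency between `x`
and `y`: `x` is a neighbor of `v`, `y` is a neighbor of `w`, and either `x` is not a
neighbor of `w` or `y` is not a neighbor of `v`. -/
def pivotCond (G : MarkedGraph V) (v w x y : V) : Prop :=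
  G.nbr v x ∧ G.nbr w y ∧ (¬ G.nbr w x ∨ ¬ G.nbr v y)

instance (G : MarkedGraph V) (v w x y : V) : Decidable (G.pivotCond v w x y) :=
  inferInstanceAs (Decidable (G.nbr v x ∧ G.nbr w y ∧ (¬ G.nbr w x ∨ ¬ G.nbr v y)))

/-- The pivot `G^{vw}`: toggle the adjacency between every pair of distinct vertices
`x, y ∉ {v,w}` such that `x` is a neighbor of `v`, `y` is a neighbor of `w`, and
either `x` is not a neighbor of `w` or `y` is not a neighbor of `v`
(loops are unaffected). -/
def pivot (G : MarkedGraph V) (v w : V) : MarkedGraph V :=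
  { G with adj := fun x y =>
      if x ≠ v ∧ x ≠ w ∧ y ≠ v ∧ y ≠ w ∧ x ≠ y ∧
          (G.pivotCond v w x y ∨ G.pivotCond v w y x)
      then G.adj x y + 1 else G.adj x y }

/-- Interchange the neighbors of `v` and `w` in an adjacency matrix, keeping loops
and the edge between `v` and `w` unchanged. -/
def swapAdjacencies (M : Matrix V V (ZMod 2)) (v w : V) : Matrix V V (ZMod 2) :=
  fun x y =>
    if x = y then M x y
    else if (x = v ∧ y = w) ∨ (x = w ∧ y = v) then M x y
    else M (Equiv.swap v w x) (Equiv.swap v w y)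

/-- The marked pivot `G_c^{vw}`: the pivot `G^{vw}` with the marks on `v` and `w`
toggled and the neighbors of `v` and `w` interchanged (loops, the edge between `v`
and `w`, and free loops unchanged). -/
def markedPivot (G : MarkedGraph V) (v w : V) : MarkedGraph V where
  adj := swapAdjacencies (G.pivot v w).adj v w
  marked := fun u => if u = v ∨ u = w then !(G.marked u) else G.marked u
  freeLoops := G.freeLoops

/-- The disjoint union of two marked graphs: block-diagonal adjacency matrix,
each vertex marked as it was, free loops added. -/
def disjUnion {V₁ V₂ : Type} [Fintype V₁] [DecidableEq V₁] [Fintype V₂] [DecidableEq V₂]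
    (G₁ : MarkedGraph V₁) (G₂ : MarkedGraph V₂) : MarkedGraph (V₁ ⊕ V₂) where
  adj := Matrix.fromBlocks G₁.adj 0 0 G₂.adj
  marked := Sum.elim G₁.marked G₂.marked
  freeLoops := G₁.freeLoops + G₂.freeLoops

/-- Remove the three edges `{u,v}`, `{u,w}`, `{v,w}` (all else unchanged). -/
def removeEdges3 (G : MarkedGraph V) (u v w : V) : MarkedGraph V :=
  { G with adj := fun x y =>
      if (x = u ∧ y = v) ∨ (x = v ∧ y = u) ∨ (x = u ∧ y = w) ∨ (x = w ∧ y = u) ∨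
          (x = v ∧ y = w) ∨ (x = w ∧ y = v)
      then 0 else G.adj x y }

/-- Adjoin one isolated, unmarked vertex with no incident edges; it is looped iff
`loop = true`. -/
def addIsolated (G : MarkedGraph V) (loop : Bool) : MarkedGraph (Option V) where
  adj := fun x y =>
    match x, y with
    | some a, some b => G.adj a b
    | none, none => if loop then 1 else 0
    | _, _ => 0
  marked := fun x => match x with | some a => G.marked a | none => false
  freeLoops := G.freeLoops

/-- The number of vertices of `s` that are adjacent to `x`. -/
def countAdj (G : MarkedGraph V) (x : V) (s : Finset V) : ℕ :=
  (s.filter fun y => G.adj x y = 1).card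

/-- The reduced marked-graph bracket `⟨G⟩ ∈ ℤ[A, A⁻¹]`: substitute `B ↦ A⁻¹` and
`d ↦ -A² - A⁻²` in `[G]`. -/
noncomputable def reducedBracket (G : MarkedGraph V) : LaurentPolynomial ℤ :=
  MvPolynomial.aeval
    ![LaurentPolynomial.T 1, LaurentPolynomial.T (-1),
      -LaurentPolynomial.T 2 - LaurentPolynomial.T (-2)] G.bracket

/-- The number of looped vertices of `G`. -/
def numLoops (G : MarkedGraph V) : ℕ :=
  (Finset.univ.filter fun v => G.adj v v = 1).card

/-- The Jones polynomial `V_G = (-1)^n ⬝ q^(3n-6ℓ) ⬝ ⟨G⟩(q⁻¹)`, as a Laurent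
polynomial in the formal variable `q` (representing `t^(1/4)`); substituting
`A ↦ q⁻¹` in `⟨G⟩` amounts to substituting `A ↦ q⁻¹`, `B ↦ q`, `d ↦ -q² - q⁻²`
in `[G]`. -/
noncomputable def jones (G : MarkedGraph V) : LaurentPolynomial ℤ :=
  (-1) ^ Fintype.card V *
    LaurentPolynomial.T (3 * (Fintype.card V : ℤ) - 6 * (G.numLoops : ℤ)) *
    MvPolynomial.aeval
      ![LaurentPolynomial.T (-1), LaurentPolynomial.T 1,
        -LaurentPolynomial.T 2 - LaurentPolynomial.T (-2)] G.bracket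

end MarkedGraph

set_option linter.unusedSimpArgs false
namespace MarkedGraph

/-- Vectors supported on `K` and killed by the rows of `M` indexed by `K`. -/
def solSpace {V : Type} [Fintype V] (M : Matrix V V (ZMod 2)) (K : Set V) :
    Submodule (ZMod 2) (V → ZMod 2) where
  carrier := {f | (∀ i, i ∉ K → f i = 0) ∧ ∀ i, i ∈ K → (M.mulVec f) i = 0}
  add_mem' := by
    rintro f g ⟨h1, h2⟩ ⟨h3, h4⟩
    refine ⟨fun i hi => by simp [h1 i hi, h3 i hi], fun i hi => ?_⟩
    rw [Matrix.mulVec_add, Pi.add_apply, h2 i hi, h4 i hi, add_zero]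
  zero_mem' := by simp
  smul_mem' := by
    rintro c f ⟨h1, h2⟩
    refine ⟨fun i hi => by simp [h1 i hi], fun i hi => ?_⟩
    rw [Matrix.mulVec_smul, Pi.smul_apply, h2 i hi, smul_zero]

lemma mem_solSpace {V : Type} [Fintype V] (M : Matrix V V (ZMod 2)) (K : Set V)
    (f : V → ZMod 2) : f ∈ solSpace M K ↔
      (∀ i, i ∉ K → f i = 0) ∧ ∀ i, i ∈ K → (M.mulVec f) i = 0 := Iff.rfl

lemma solSpace_congr {V : Type} [Fintype V] (M M' : Matrix V V (ZMod 2)) (K K' : Set V)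
    (hK : ∀ x, x ∈ K ↔ x ∈ K') (hM : ∀ x ∈ K, ∀ y ∈ K, M x y = M' x y) :
    solSpace M K = solSpace M' K' := by
  obtain rfl : K = K' := Set.ext hK
  ext f
  rw [mem_solSpace, mem_solSpace]
  refine and_congr_right fun h0 => forall_congr' fun i => imp_congr_right fun hi => ?_
  have : M.mulVec f i = M'.mulVec f i := by
    simp only [Matrix.mulVec, dotProduct]
    refine Finset.sum_congr rfl fun j _ => ?_
    by_cases hj : j ∈ K
    · rw [hM i hi j hj]
    · rw [h0 j hj]; simp
  rw [this]

lemma finrank_eq_of_maps {W W' : Type*} [AddCommGroup W] [Module (ZMod 2) W]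
    [AddCommGroup W'] [Module (ZMod 2) W']
    (S : Submodule (ZMod 2) W) (S' : Submodule (ZMod 2) W')
    (P : W →ₗ[ZMod 2] W') (Q : W' →ₗ[ZMod 2] W)
    (h1 : ∀ f ∈ S, P f ∈ S' ∧ Q (P f) = f) (h2 : ∀ g ∈ S', Q g ∈ S ∧ P (Q g) = g) :
    Module.finrank (ZMod 2) S = Module.finrank (ZMod 2) S' := by
  refine LinearEquiv.finrank_eq (LinearEquiv.ofLinearMap
    (P.restrict (fun f hf => (h1 f hf).1)) (Q.restrict (fun g hg => (h2 g hg).1)) ?_ ?_)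
  · ext ⟨g, hg⟩ : 2
    simpa using (h2 g hg).2
  · ext ⟨f, hf⟩ : 2
    simpa using (h1 f hf).2

lemma nullity_eq_solSpace {V ι : Type} [Fintype V] [DecidableEq V] [Fintype ι] (e : ι → V)
    (he : Function.Injective e) (N : Matrix ι ι (ZMod 2)) (M : Matrix V V (ZMod 2)) (K : Set V)
    (hK : ∀ x, x ∈ K ↔ ∃ i, e i = x) (hN : ∀ i j, N i j = M (e i) (e j)) :
    nullity N = Module.finrank (ZMod 2) (solSpace M K) := by
  unfold nullity
  classical
  symm
  have key : ∀ f : V → ZMod 2, (∀ i, i ∉ K → f i = 0) → ∀ i,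
      M.mulVec f (e i) = N.mulVec (fun j => f (e j)) i := by
    intro f hf i
    simp only [Matrix.mulVec, dotProduct]
    rw [← Finset.sum_subset (Finset.subset_univ (Finset.univ.image e)),
      Finset.sum_image (fun a _ b _ h => he h)]
    · exact Finset.sum_congr rfl fun j _ => by rw [hN]
    · intro x _ hx
      rw [hf x, mul_zero]
      rw [hK]
      simpa using hx
  let Q : (ι → ZMod 2) →ₗ[ZMod 2] (V → ZMod 2) := Function.ExtendByZero.linearMap (ZMod 2) e
  have hQ : ∀ g i, Q g (e i) = g i := fun g i => he.extend_apply _ _ _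
  have hQ0 : ∀ g x, x ∉ K → Q g x = 0 := fun g x hx =>
    Function.extend_apply' _ _ _ (by rwa [hK] at hx)
  refine finrank_eq_of_maps _ _ (LinearMap.funLeft (ZMod 2) (ZMod 2) e) Q ?_ ?_
  · rintro f ⟨h1, h2⟩
    constructor
    · rw [LinearMap.mem_ker]
      ext i
      have := key f h1 i
      rw [h2 _ ((hK _).2 ⟨i, rfl⟩)] at this
      exact this.symm
    · ext x
      by_cases hx : x ∈ K
      · obtain ⟨i, rfl⟩ := (hK x).1 hx
        rw [hQ]; rfl
      · rw [hQ0 _ _ hx, h1 x hx]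
  · intro g hg
    rw [LinearMap.mem_ker] at hg
    have hg' : (fun j => Q g (e j)) = g := funext fun j => hQ g j
    refine ⟨⟨hQ0 g, ?_⟩, hg'⟩
    intro x hx
    obtain ⟨i, rfl⟩ := (hK x).1 hx
    rw [key _ (hQ0 g), hg']
    exact congrFun hg i

lemma zmod2_cases (a : ZMod 2) : a = 0 ∨ a = 1 := by
  revert a; decide

/-- Elimination at one vertex. -/
lemma elim_one {V : Type} [Fintype V] [DecidableEq V] (M : Matrix V V (ZMod 2)) (K : Set V)
    (v : V) (hv : v ∈ K) (hM : M v v = 1) :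
    Module.finrank (ZMod 2) (solSpace M K) =
      Module.finrank (ZMod 2)
        (solSpace (Matrix.of fun x y => M x y + M x v * M v y) (K \ {v})) := by
  let E : Matrix V V (ZMod 2) := 1 - Matrix.single v v 1
  let D : Matrix V V (ZMod 2) := 1 + Matrix.of (fun x y => if x = v then M v y else 0)
  have hE : ∀ f : V → ZMod 2, E.mulVec f = fun x => if x = v then 0 else f x := by
    intro f
    ext x
    simp only [E, Matrix.sub_mulVec, Matrix.one_mulVec, Pi.sub_apply, Matrix.single_mulVec]
    by_cases h : x = v <;> simp [h, Function.update]
  have hD : ∀ f : V → ZMod 2, D.mulVec f =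
      fun x => f x + if x = v then M.mulVec f v else 0 := by
    intro f
    ext x
    simp only [D, Matrix.add_mulVec, Matrix.one_mulVec, Pi.add_apply]
    by_cases h : x = v <;> simp [h, Matrix.mulVec, dotProduct]
  have hM' : ∀ (f : V → ZMod 2) x,
      (Matrix.of fun x y => M x y + M x v * M v y).mulVec f x =
      M.mulVec f x + M x v * M.mulVec f v := by
    intro f x
    simp only [Matrix.mulVec, dotProduct, Matrix.of_apply, Finset.mul_sum,
      ← Finset.sum_add_distrib]
    exact Finset.sum_congr rfl fun j _ => by ring
  have hsplit : ∀ (f : V → ZMod 2) x,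
      M.mulVec f x = M x v * f v + M.mulVec (fun y => if y = v then 0 else f y) x := by
    intro f x
    simp only [Matrix.mulVec, dotProduct]
    rw [← Finset.add_sum_erase _ _ (Finset.mem_univ v),
      ← Finset.add_sum_erase _ (fun y => M x y * if y = v then 0 else f y) (Finset.mem_univ v)]
    simp only [if_true, mul_zero, zero_add]
    congr 1
    refine Finset.sum_congr rfl fun j hj => ?_
    rw [if_neg (Finset.ne_of_mem_erase hj)]
  refine finrank_eq_of_maps _ _ E.mulVecLin D.mulVecLin ?_ ?_
  · rintro f ⟨h1, h2⟩
    simp only [Matrix.mulVecLin_apply, hE, hD]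
    have hvv := h2 v hv
    rw [hsplit, hM] at hvv
    refine ⟨⟨?_, ?_⟩, ?_⟩
    · intro i hi
      by_cases h : i = v
      · simp [h]
      · simp only [h, if_false]
        exact h1 i fun hk => hi ⟨hk, h⟩
    · intro i hi
      rw [hM']
      have := h2 i hi.1
      rw [hsplit] at this
      grind
    · ext x
      by_cases h : x = v
      · subst h
        simp only [if_true]
        grind
      · simp [h]
  · rintro g ⟨h1, h2⟩
    have hgv : g v = 0 := h1 v (by simp)
    have hg : (fun x => if x = v then 0 else g x) = g := by
      ext x; by_cases h : x = v <;> simp [h, hgv]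
    have hg' : (fun y => if y = v then (0 : ZMod 2) else
        (g y + if y = v then M.mulVec g v else 0)) = g := by
      ext x; by_cases h : x = v <;> simp [h, hgv]
    simp only [Matrix.mulVecLin_apply, hE, hD]
    refine ⟨⟨?_, ?_⟩, hg'⟩
    · intro i hi
      have h : i ≠ v := by rintro rfl; exact hi hv
      simp only [h, if_false, add_zero]
      exact h1 i fun hk => hi hk.1
    · intro i hi
      rw [hsplit, hg']
      simp only [if_true, hgv]
      by_cases h : i = v
      · subst h; grind
      · have := h2 i ⟨hi, h⟩
        rw [hM'] at this
        grind

/-- Elimination at two vertices. -/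
lemma elim_two {V : Type} [Fintype V] [DecidableEq V] (M : Matrix V V (ZMod 2)) (K : Set V)
    (v w : V) (hvw : v ≠ w) (hv : v ∈ K) (hw : w ∈ K) (hM : M v v = 0) (hM1 : M v w = 1)
    (hM2 : M w v = 1) :
    Module.finrank (ZMod 2) (solSpace M K) =
      Module.finrank (ZMod 2)
        (solSpace (Matrix.of fun x y => M x y + M x v * (M w w * M v y + M w y) + M x w * M v y)
          (K \ {v, w})) := by
  let E : Matrix V V (ZMod 2) := Matrix.of fun x y => if x = v ∨ x = w then 0 else if x = y then 1 else 0
  let D : Matrix V V (ZMod 2) := 1 + Matrix.of (fun x y => if x = v then (M w w * M v y + M w y)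
    else if x = w then M v y else 0)
  have hE : ∀ f : V → ZMod 2, E.mulVec f = fun x => if x = v ∨ x = w then 0 else f x := by
    intro f
    ext x
    by_cases h : x = v ∨ x = w <;> simp [h, E, Matrix.mulVec, dotProduct]
  have hD : ∀ f : V → ZMod 2, D.mulVec f =
      fun x => f x + if x = v then M w w * M.mulVec f v + M.mulVec f w
        else if x = w then M.mulVec f v else 0 := by
    intro f
    ext x
    simp only [D, Matrix.add_mulVec, Matrix.one_mulVec, Pi.add_apply]
    congr 1
    by_cases h : x = v
    · simp [h, Matrix.mulVec, dotProduct, Finset.mul_sum, ← Finset.sum_add_distrib]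
      exact Finset.sum_congr rfl fun j _ => by ring
    · by_cases h' : x = w <;> simp [h, h', hvw.symm, Matrix.mulVec, dotProduct]
  have hM' : ∀ (f : V → ZMod 2) x,
      (Matrix.of fun x y => M x y + M x v * (M w w * M v y + M w y) + M x w * M v y).mulVec f x =
      M.mulVec f x + M x v * (M w w * M.mulVec f v + M.mulVec f w) + M x w * M.mulVec f v := by
    intro f x
    simp only [Matrix.mulVec, dotProduct, Matrix.of_apply, Finset.mul_sum,
      ← Finset.sum_add_distrib]
    exact Finset.sum_congr rfl fun j _ => by ring
  have hsplit : ∀ (f : V → ZMod 2) x,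
      M.mulVec f x = M x v * f v + M x w * f w +
        M.mulVec (fun y => if y = v ∨ y = w then 0 else f y) x := by
    intro f x
    have hwm : w ∈ Finset.univ.erase v := by simp [hvw.symm]
    simp only [Matrix.mulVec, dotProduct]
    rw [← Finset.add_sum_erase _ _ (Finset.mem_univ v), ← Finset.add_sum_erase _ _ hwm,
      ← Finset.add_sum_erase _ (fun y => M x y * if y = v ∨ y = w then 0 else f y)
        (Finset.mem_univ v), ← Finset.add_sum_erase _ _ hwm]
    simp only [true_or, or_true, if_true, mul_zero, zero_add, add_assoc]
    congr 2
    refine Finset.sum_congr rfl fun j hj => ?_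
    simp only [Finset.mem_erase] at hj
    rw [if_neg (by tauto)]
  refine finrank_eq_of_maps _ _ E.mulVecLin D.mulVecLin ?_ ?_
  · rintro f ⟨h1, h2⟩
    simp only [Matrix.mulVecLin_apply, hE, hD]
    have hvv := h2 v hv
    have hww := h2 w hw
    rw [hsplit, hM, hM1] at hvv
    rw [hsplit, hM2] at hww
    refine ⟨⟨?_, ?_⟩, ?_⟩
    · intro i hi
      by_cases h : i = v ∨ i = w
      · simp [h]
      · simp only [h, if_false]
        exact h1 i fun hk => hi ⟨hk, h⟩
    · intro i hi
      rw [hM']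
      have := h2 i hi.1
      rw [hsplit] at this
      grind
    · ext x
      by_cases h : x = v
      · subst h
        simp only [if_true, true_or]
        grind
      · by_cases h' : x = w
        · subst h'
          simp only [if_true, or_true, h, if_false]
          grind
        · simp [h, h']
  · rintro g ⟨h1, h2⟩
    have hgv : g v = 0 := h1 v (by simp)
    have hgw : g w = 0 := h1 w (by simp)
    have hg' : (fun y => if y = v ∨ y = w then (0 : ZMod 2) else
        (g y + if y = v then M w w * M.mulVec g v + M.mulVec g w
        else if y = w then M.mulVec g v else 0)) = g := by
      ext x
      by_cases h : x = v
      · simp [h, hgv]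
      · by_cases h' : x = w <;> simp [h, h', hgw]
    simp only [Matrix.mulVecLin_apply, hE, hD]
    refine ⟨⟨?_, ?_⟩, hg'⟩
    · intro i hi
      have h : i ≠ v := by rintro rfl; exact hi hv
      have h' : i ≠ w := by rintro rfl; exact hi hw
      simp only [h, h', if_false, add_zero]
      exact h1 i fun hk => hi hk.1
    · intro i hi
      rw [hsplit, hg']
      simp only [if_true, hgv, hgw, hvw.symm, if_false]
      by_cases h : i = v
      · subst h; grind
      · by_cases h' : i = w
        · subst h'; grind
        · have := h2 i ⟨hi, by simp [h, h']⟩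
          rw [hM'] at this
          grind

/-- A set of remaining vertices seen as a subset of `V`. -/
abbrev up {V : Type} {s : Finset V} (T' : Finset {x : V // x ∉ s}) : Finset V :=
  T'.map (Function.Embedding.subtype _)

lemma mem_up {V : Type} {s : Finset V} (T' : Finset {x : V // x ∉ s}) (x : V) :
    x ∈ up T' ↔ ∃ h : x ∉ s, (⟨x, h⟩ : {x : V // x ∉ s}) ∈ T' := by
  simp [up]

lemma nullity_subMat {V : Type} [Fintype V] [DecidableEq V] (G : MarkedGraph V) (T : Finset V) :
    nullity (G.subMat T) = Module.finrank (ZMod 2) (solSpace (G.adj + delta T) (G.keep T)) := by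
  refine nullity_eq_solSpace (fun i : G.keep T => i.1) Subtype.val_injective _ _ _ ?_ ?_
  · intro x; simp
  · intro i j; rfl

lemma delete_adj {V : Type} [Fintype V] [DecidableEq V] (H : MarkedGraph V) (s : Finset V)
    (i j : {x : V // x ∉ s}) : (H.delete s).adj i j = H.adj i.1 j.1 := rfl

lemma delete_marked {V : Type} [Fintype V] [DecidableEq V] (H : MarkedGraph V) (s : Finset V)
    (i : {x : V // x ∉ s}) : (H.delete s).marked i = H.marked i.1 := rfl

lemma nullity_delete {V : Type} [Fintype V] [DecidableEq V] (H : MarkedGraph V) (s : Finset V)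
    (T' : Finset {x : V // x ∉ s}) :
    nullity ((H.delete s).subMat T') = Module.finrank (ZMod 2)
      (solSpace (H.adj + delta (up T')) ((H.keep (up T') : Set V) \ s)) := by
  refine nullity_eq_solSpace (fun i : (H.delete s).keep T' => i.1.1)
    (Subtype.val_injective.comp Subtype.val_injective) _ _ _ ?_ ?_
  · intro x
    constructor
    · rintro ⟨h1, h2⟩
      refine ⟨⟨⟨x, h2⟩, ?_⟩, rfl⟩
      have h2' : x ∉ s := h2
      simpa [keep, delete_adj, delete_marked, delta, h2'] using h1
    · rintro ⟨⟨⟨y, h2⟩, hy⟩, rfl⟩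
      refine ⟨?_, h2⟩
      simpa [keep, delete_adj, delete_marked, delta, h2] using hy
  · rintro ⟨⟨i, hi⟩, hi'⟩ ⟨⟨j, hj⟩, hj'⟩
    simp only [subMat, delete_adj, delta, Matrix.add_apply, Matrix.diagonal_apply]
    simp [hi]

lemma sum_up {V : Type} [Fintype V] [DecidableEq V] (s : Finset V) {R : Type*} [AddCommMonoid R]
    (F : Finset V → R) :
    ∑ T ∈ (Finset.univ \ s).powerset, F T = ∑ T' : Finset {x : V // x ∉ s}, F (up T') := by
  symm
  refine Finset.sum_nbij' (fun T' => up T') (fun T => T.subtype (fun x => x ∉ s)) ?_ ?_ ?_ ?_ ?_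
  · intro T' _
    rw [Finset.mem_powerset]
    intro x hx
    obtain ⟨h, _⟩ := (mem_up T' x).1 hx
    simp [h]
  · simp
  · intro T' _; ext x; simp [x.2]
  · intro T hT
    rw [Finset.mem_powerset] at hT
    ext x
    have := @hT x
    simp at this
    simp
    tauto
  · intros; rfl

end MarkedGraph

namespace MarkedGraph

lemma localComp_adj {V : Type} [Fintype V] [DecidableEq V] (G : MarkedGraph V) (v x y : V) :
    (G.localComp v).adj x y = if G.nbr v x ∧ G.nbr v y then G.adj x y + 1 else G.adj x y := rfl

lemma localComp_marked {V : Type} [Fintype V] [DecidableEq V] (G : MarkedGraph V) (v x : V) :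
    (G.localComp v).marked x = G.marked x := rfl

lemma pivot_adj {V : Type} [Fintype V] [DecidableEq V] (G : MarkedGraph V) (v w x y : V) :
    (G.pivot v w).adj x y = if x ≠ v ∧ x ≠ w ∧ y ≠ v ∧ y ≠ w ∧ x ≠ y ∧
          (G.pivotCond v w x y ∨ G.pivotCond v w y x)
      then G.adj x y + 1 else G.adj x y := rfl

lemma pivot_marked {V : Type} [Fintype V] [DecidableEq V] (G : MarkedGraph V) (v w x : V) :
    (G.pivot v w).marked x = G.marked x := rfl

lemma case_one {V : Type} [Fintype V] [DecidableEq V]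
    (G : MarkedGraph V) (hsym : G.adj.IsSymm) (v : V)
    (hv : G.adj v v = 0) (hmv : G.marked v = false)
    (hnbr : ∀ x, G.nbr v x → G.marked x = false) (T' : Finset {x : V // x ∉ ({v} : Finset V)}) :
    nullity (G.subMat (insert v (up T'))) =
      nullity (((G.localComp v).delete {v}).subMat T') := by
  have hs : ∀ x y, G.adj x y = G.adj y x := fun x y => hsym.apply y x
  rw [nullity_subMat, nullity_delete, elim_one _ _ v]
  · refine congrArg (fun S : Submodule (ZMod 2) (V → ZMod 2) => Module.finrank (ZMod 2) S)
      (solSpace_congr _ _ _ _ ?_ ?_)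
    · intro x
      by_cases hx : x = v
      · simp [hx]
      have := hnbr x
      simp only [nbr] at this
      by_cases h1 : G.adj v x = 1
      · simp [keep, hx, this ⟨hx, h1⟩, localComp_adj, localComp_marked]
      · simp [keep, hx, h1, localComp_adj, localComp_marked, nbr, delta]
    · rintro x ⟨-, hx⟩ y ⟨-, hy⟩
      have hx : x ≠ v := hx
      have hy : y ≠ v := hy
      have e : G.adj x v = G.adj v x := hs _ _
      simp only [Matrix.of_apply, Matrix.add_apply, delta, Matrix.diagonal_apply, localComp_adj, localComp_marked, nbr,
        hx, hy, hx.symm, hy.symm, if_false, ne_eq, not_false_eq_true, true_and, add_zero,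
        Finset.mem_insert, false_or, e]
      rcases zmod2_cases (G.adj v x) with h1 | h1 <;>
      rcases zmod2_cases (G.adj v y) with h2 | h2 <;> simp [h1, h2]
      ring
  · simp [keep, hmv]
  · simp [delta, hv]

lemma case_two {V : Type} [Fintype V] [DecidableEq V]
    (G : MarkedGraph V) (hsym : G.adj.IsSymm) (v w : V)
    (hvw : v ≠ w) (hadj : G.adj v w = 1)
    (hv : G.adj v v = 0) (hw : G.adj w w = 0)
    (hmv : G.marked v = false) (hmw : G.marked w = false)
    (T' : Finset {x : V // x ∉ ({v, w} : Finset V)}) :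
    nullity (G.subMat (up T')) = nullity (((G.pivot v w).delete {v, w}).subMat T') := by
  have hs : ∀ x y, G.adj x y = G.adj y x := fun x y => hsym.apply y x
  have hadj' : G.adj w v = 1 := by rw [hs, hadj]
  rw [nullity_subMat, nullity_delete, elim_two _ _ v w hvw]
  · refine congrArg (fun S : Submodule (ZMod 2) (V → ZMod 2) => Module.finrank (ZMod 2) S)
      (solSpace_congr _ _ _ _ ?_ ?_)
    · intro x
      simp [keep, pivot_adj, pivot_marked, delta]
    · rintro x ⟨-, hx⟩ y ⟨-, hy⟩
      simp only [Set.mem_insert_iff, Set.mem_singleton_iff, not_or] at hx hy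
      obtain ⟨hxv, hxw⟩ := hx
      obtain ⟨hyv, hyw⟩ := hy
      have e : G.adj x v = G.adj v x := hs _ _
      have e' : G.adj x w = G.adj w x := hs _ _
      have hwT : w ∉ up T' := by rw [mem_up]; simp
      simp only [Matrix.of_apply, Matrix.add_apply, delta, Matrix.diagonal_apply, pivot_adj, pivot_marked, pivotCond,
        nbr, hxv, hxw, hyv, hyw, Ne.symm hxv, Ne.symm hxw, Ne.symm hyv, Ne.symm hyw, if_false,
        ne_eq, not_false_eq_true, true_and, add_zero, e, e', hwT, hw, if_true]
      by_cases hxy : x = y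
      · subst hxy
        rcases zmod2_cases (G.adj v x) with h1 | h1 <;>
        rcases zmod2_cases (G.adj w x) with h2 | h2 <;> simp [h1, h2]
        grind
      · rcases zmod2_cases (G.adj v x) with h1 | h1 <;>
        rcases zmod2_cases (G.adj v y) with h2 | h2 <;>
        rcases zmod2_cases (G.adj w x) with h3 | h3 <;>
        rcases zmod2_cases (G.adj w y) with h4 | h4 <;> simp [h1, h2, h3, h4, hxy] <;> grind
  · simp [keep, hmv]
  · simp [keep, hmw]
  · have : v ∉ up T' := by rw [mem_up]; simp
    simp only [Matrix.add_apply, delta, Matrix.diagonal_apply_eq, hv, this, if_false, add_zero]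
  · simp [delta, hadj, hvw]
  · simp [delta, hadj', hvw.symm]

lemma case_three {V : Type} [Fintype V] [DecidableEq V]
    (G : MarkedGraph V) (hsym : G.adj.IsSymm) (v w : V)
    (hvw : v ≠ w) (hadj : G.adj v w = 1)
    (hv : G.adj v v = 0) (hw : G.adj w w = 0)
    (hmv : G.marked v = false) (hmw : G.marked w = false)
    (hnbr : ∀ x, G.nbr v x → G.marked x = false)
    (T' : Finset {x : V // x ∉ ({v, w} : Finset V)}) :
    nullity (G.subMat (insert w (up T'))) =
      nullity ((((G.pivot v w).localComp v).delete {v, w}).subMat T') := by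
  have hs : ∀ x y, G.adj x y = G.adj y x := fun x y => hsym.apply y x
  have hadj' : G.adj w v = 1 := by rw [hs, hadj]
  have hpv : ∀ x, (G.pivot v w).adj v x = G.adj v x := by intro x; simp [pivot_adj, pivot_marked]
  rw [nullity_subMat, nullity_delete, elim_two _ _ v w hvw]
  · refine congrArg (fun S : Submodule (ZMod 2) (V → ZMod 2) => Module.finrank (ZMod 2) S)
      (solSpace_congr _ _ _ _ ?_ ?_)
    · intro x
      by_cases hxv : x = v
      · simp [hxv]
      by_cases hxw : x = w
      · simp [hxw]
      have := hnbr x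
      simp only [nbr] at this
      by_cases h1 : G.adj v x = 1
      · simp [keep, hxv, hxw, this ⟨hxv, h1⟩, localComp_adj, localComp_marked, pivot_adj, pivot_marked]
      · simp [keep, localComp_adj, localComp_marked, nbr, hpv, h1, hxv, hxw, delta, pivot_adj,
          pivot_marked]
    · rintro x ⟨-, hx⟩ y ⟨-, hy⟩
      simp only [Set.mem_insert_iff, Set.mem_singleton_iff, not_or] at hx hy
      obtain ⟨hxv, hxw⟩ := hx
      obtain ⟨hyv, hyw⟩ := hy
      have e : G.adj x v = G.adj v x := hs _ _
      have e' : G.adj x w = G.adj w x := hs _ _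
      simp only [Matrix.of_apply, Matrix.add_apply, delta, Matrix.diagonal_apply, localComp_adj,
        nbr, hpv]
      simp only [Matrix.of_apply, Matrix.add_apply, delta, Matrix.diagonal_apply, pivot_adj, pivot_marked, pivotCond,
        nbr, hxv, hxw, hyv, hyw, Ne.symm hxv, Ne.symm hxw, Ne.symm hyv, Ne.symm hyw, if_false,
        ne_eq, not_false_eq_true, true_and, add_zero, e, e', hw, if_true, Finset.mem_insert,
        true_or, false_or]
      by_cases hxy : x = y
      · subst hxy
        rcases zmod2_cases (G.adj v x) with h1 | h1 <;>
        rcases zmod2_cases (G.adj w x) with h2 | h2 <;> simp [h1, h2] <;> grind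
      · rcases zmod2_cases (G.adj v x) with h1 | h1 <;>
        rcases zmod2_cases (G.adj v y) with h2 | h2 <;>
        rcases zmod2_cases (G.adj w x) with h3 | h3 <;>
        rcases zmod2_cases (G.adj w y) with h4 | h4 <;> simp [h1, h2, h3, h4, hxy] <;> grind
  · simp [keep, hmv]
  · simp [keep, hmw]
  · have : v ∉ insert w (up T') := by rw [Finset.mem_insert, mem_up]; simp [hvw]
    simp only [Matrix.add_apply, delta, Matrix.diagonal_apply_eq, hv, this, if_false, add_zero]
  · simp [delta, hadj, hvw]
  · simp [delta, hadj', hvw.symm]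

lemma card_add_of_delete {V : Type} [Fintype V] [DecidableEq V] (s : Finset V) :
    Fintype.card {x : V // x ∉ s} + s.card = Fintype.card V := by
  rw [Fintype.card_subtype_compl, Fintype.card_coe]
  exact Nat.sub_add_cancel (Finset.card_le_univ s)

end MarkedGraph
/-- If `v` and `w` are adjacent, unlooped, unmarked vertices and no
neighbor of `v` is marked then
`[G] = A²⬝[G^{vw} - v - w] + AB⬝[(G^{vw})^v - v - w] + B⬝[G^v - v]`. -/
theorem bracket_pivot_recursion {V : Type} [Fintype V] [DecidableEq V]
    (G : MarkedGraph V) (hsym : G.adj.IsSymm) (v w : V)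
    (hvw : v ≠ w) (hadj : G.adj v w = 1)
    (hv : G.adj v v = 0) (hw : G.adj w w = 0)
    (hmv : G.marked v = false) (hmw : G.marked w = false)
    (hnbr : ∀ x, G.nbr v x → G.marked x = false) :
    G.bracket =
      X 0 ^ 2 * ((G.pivot v w).delete {v, w}).bracket +
        X 0 * X 1 * (((G.pivot v w).localComp v).delete {v, w}).bracket +
        X 1 * ((G.localComp v).delete {v}).bracket := by
  have hsum : ∀ F : Finset V → MvPolynomial (Fin 3) ℤ, ∑ T, F T =
      ∑ T' : Finset {x : V // x ∉ ({v, w} : Finset V)}, F (MarkedGraph.up T') +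
      ∑ T' : Finset {x : V // x ∉ ({v, w} : Finset V)}, F (insert w (MarkedGraph.up T')) +
      ∑ T' : Finset {x : V // x ∉ ({v} : Finset V)}, F (insert v (MarkedGraph.up T')) := by
    intro F
    rw [← MarkedGraph.sum_up {v, w} F, ← MarkedGraph.sum_up {v, w} (fun T => F (insert w T)),
      ← MarkedGraph.sum_up {v} (fun T => F (insert v T))]
    have e1 : (Finset.univ : Finset V) = insert v (Finset.univ \ {v}) := by
      ext x; by_cases h : x = v <;> simp [h]
    have e2 : (Finset.univ : Finset V) \ {v} = insert w (Finset.univ \ {v, w}) := by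
      ext x
      by_cases h : x = w
      · simp [h, hvw.symm]
      · simp [h]
    rw [← Finset.powerset_univ]
    conv_lhs => rw [e1]
    rw [Finset.sum_powerset_insert (by simp)]
    congr 1
    rw [e2, Finset.sum_powerset_insert (by simp)]
  have c2 := MarkedGraph.card_add_of_delete ({v, w} : Finset V)
  have c1 := MarkedGraph.card_add_of_delete ({v} : Finset V)
  rw [Finset.card_pair hvw] at c2
  rw [Finset.card_singleton] at c1
  have hf1 : ((G.pivot v w).delete {v, w}).freeLoops = G.freeLoops := rfl
  have hf2 : (((G.pivot v w).localComp v).delete {v, w}).freeLoops = G.freeLoops := rfl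
  have hf3 : ((G.localComp v).delete {v}).freeLoops = G.freeLoops := rfl
  unfold MarkedGraph.bracket
  rw [hsum, hf1, hf2, hf3, mul_add, mul_add]
  congr 1
  · congr 1
    · rw [mul_left_comm]
      congr 1
      rw [Finset.mul_sum]
      refine Finset.sum_congr rfl fun T' _ => ?_
      rw [MarkedGraph.case_two G hsym v w hvw hadj hv hw hmv hmw T']
      have hT := Finset.card_le_univ T'
      have h1 : (MarkedGraph.up T').card = T'.card := Finset.card_map _
      have h2 : Fintype.card V - T'.card =
        (Fintype.card {x : V // x ∉ ({v, w} : Finset V)} - T'.card) + 2 := by omega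
      rw [h1, h2]
      ring
    · rw [mul_left_comm]
      congr 1
      rw [Finset.mul_sum]
      refine Finset.sum_congr rfl fun T' _ => ?_
      rw [MarkedGraph.case_three G hsym v w hvw hadj hv hw hmv hmw hnbr T']
      have hT := Finset.card_le_univ T'
      have h1 : (insert w (MarkedGraph.up T')).card = T'.card + 1 := by
        rw [Finset.card_insert_of_notMem (by rw [MarkedGraph.mem_up]; simp), Finset.card_map]
      have h2 : Fintype.card V - (T'.card + 1) =
        (Fintype.card {x : V // x ∉ ({v, w} : Finset V)} - T'.card) + 1 := by omega
      rw [h1, h2]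
      ring
  · rw [mul_left_comm]
    congr 1
    rw [Finset.mul_sum]
    refine Finset.sum_congr rfl fun T' _ => ?_
    rw [MarkedGraph.case_one G hsym v hv hmv hnbr T']
    have hT := Finset.card_le_univ T'
    have h1 : (insert v (MarkedGraph.up T')).card = T'.card + 1 := by
      rw [Finset.card_insert_of_notMem (by rw [MarkedGraph.mem_up]; simp), Finset.card_map]
    have h2 : Fintype.card V - (T'.card + 1) =
      (Fintype.card {x : V // x ∉ ({v} : Finset V)} - T'.card) := by omega
    rw [h1, h2]
    ring
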